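/- Suppose a Beurling generalized number system satisfies N(x) = Ax + O(x^θ) for some A > 0 and θ ∈ [0,1). Then for each α > θ there is a constant C_α such that for each T > 2, the number of zeros ρ = β + iγ of the associated Beurling zeta function (i.e. of its analytic continuation to {Re s > θ} \ {1}) satisfying β ∈ [α, 1] and |γ| ∈ [T, T+1] is at most C_α log T. -/

import Mathlib

open Filter Topology

/-- A Beurling generalized prime number system: a nondecreasing sequence of
generalized primes, each `> 1`, tending to infinity. -/
structure BeurlingSystem where
  p : ℕ → ℝ
  one_lt_p : ∀ k, 1 < p k
  p_mono : Monotone p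
  p_tendsto : Filter.Tendsto p Filter.atTop Filter.atTop

namespace BeurlingSystem

variable (S : BeurlingSystem)

/-- The numerical value of a generalized integer, encoded as the finitely supported
vector of exponents of the generalized primes. -/
noncomputable def val (n : ℕ →₀ ℕ) : ℝ := n.prod fun k e => S.p k ^ e

/-- The integer counting function `N(x)`. -/
noncomputable def cnt (x : ℝ) : ℝ := (Set.ncard {n : ℕ →₀ ℕ | S.val n ≤ x} : ℝ)

/-- `χ(x, λ)`: the number of generalized integers within distance `λ` of `x`. -/
noncomputable def chi (x lam : ℝ) : ℝ := (Set.ncard {n : ℕ →₀ ℕ | |x - S.val n| ≤ lam} : ℝ)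

/-- The integers are `θ`-well-behaved with density `A` and implied constant `K₀`:
`N(x) = A x + O(x^θ)`. -/
def WellBehaved (A θ K₀ : ℝ) : Prop :=
  0 < A ∧ 0 ≤ θ ∧ θ < 1 ∧ 0 ≤ K₀ ∧ ∀ x : ℝ, 1 ≤ x → |S.cnt x - A * x| ≤ K₀ * x ^ θ

/-- `ζ` is (the unique) analytic continuation of the Beurling zeta function
to `{Re s > θ} \ {1}`. -/
def IsZeta (θ : ℝ) (ζ : ℂ → ℂ) : Prop :=
  DifferentiableOn ℂ ζ {s : ℂ | θ < s.re ∧ s ≠ 1} ∧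
  ∀ s : ℂ, 1 < s.re → ζ s = ∑' n : ℕ →₀ ℕ, (S.val n : ℂ) ^ (-s)

/-- The von Mangoldt function: `log p` on prime powers `p^m`, `0` otherwise. -/
noncomputable def vonMangoldt (n : ℕ →₀ ℕ) : ℝ :=
  ∑ k ∈ n.support, if n.support = {k} then Real.log (S.p k) else 0

/-- The Chebyshev function `ψ(x)`. -/
noncomputable def psi (x : ℝ) : ℝ :=
  ∑ᶠ n ∈ {n : ℕ →₀ ℕ | S.val n ≤ x}, S.vonMangoldt n

end BeurlingSystem

/-- The generalized divisor function: the number of ordered pairs of generalized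
integers whose formal product equals `n`. -/
noncomputable def gDivisor (n : ℕ →₀ ℕ) : ℝ :=
  (Set.ncard {q : (ℕ →₀ ℕ) × (ℕ →₀ ℕ) | q.1 + q.2 = n} : ℝ)

/-- The generalized Möbius function. -/
noncomputable def gMoebius (n : ℕ →₀ ℕ) : ℝ :=
  if ∀ k ∈ n.support, n k ≤ 1 then (-1 : ℝ) ^ n.support.card else 0

/-- The zero-counting function `N(α, T)` of the (continued) zeta function. -/
noncomputable def zeroCount (ζ : ℂ → ℂ) (α T : ℝ) : ℝ :=
  (Set.ncard {ρ : ℂ | ζ ρ = 0 ∧ ρ ≠ 1 ∧ α ≤ ρ.re ∧ |ρ.im| ≤ T} : ℝ)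

open MeasureTheory Metric in
/-- A form of Jensen's inequality counting distinct zeros. -/
theorem AnalyticOnNhd.ncard_zeros_le {c : ℂ} {r R M : ℝ} {f : ℂ → ℂ} {Z : Set ℂ} (hr : 0 < r)
    (hrR : r < R) (hM : 1 ≤ M) (hf : AnalyticOnNhd ℂ f (closedBall c R)) (hfc : f c ≠ 0)
    (hbound : ∀ z ∈ sphere c R, ‖f z‖ ≤ M) (hZ : Z ⊆ closedBall c r) (hZf : ∀ z ∈ Z, f z = 0) :
    Z.Finite ∧ (Z.ncard : ℝ) ≤ Real.log (M / ‖f c‖) / Real.log (R / r) := by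
  have hR : 0 < R := hr.trans hrR
  have hf' : AnalyticOnNhd ℂ f (closedBall c r) := hf.mono (closedBall_subset_closedBall hrR.le)
  have key := AnalyticOnNhd.sum_divisor_le (c := c) (r := r) (R := R) (M := M) (f := f)
    (by positivity) (by rwa [abs_of_pos hr, abs_of_pos hR]) hM (by rwa [abs_of_pos hR]) hfc
    (by rwa [abs_of_pos hR])
  rw [abs_of_pos hr] at key
  set D := MeromorphicOn.divisor f (closedBall c r)
  have hfin : (Function.support D).Finite := D.finiteSupport (isCompact_closedBall c r)
  have hpos : ∀ u, 0 ≤ D u := fun u => MeromorphicOn.AnalyticOnNhd.divisor_nonneg hf' u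
  have hone : ∀ z ∈ Z, 1 ≤ D z := by
    intro z hz
    have hzb := hZ hz
    have h0 : analyticOrderAt f z ≠ 0 := by
      rw [(hf' z hzb).analyticOrderAt_ne_zero]
      exact hZf z hz
    have htop : analyticOrderAt f z ≠ ⊤ := by
      intro h
      rw [analyticOrderAt_eq_top] at h
      exact hfc (hf'.eqOn_zero_of_preconnected_of_eventuallyEq_zero isPreconnected_closedBall
        hzb h (mem_closedBall_self hr.le))
    have hD : D z = (analyticOrderNatAt f z : ℤ) := by
      simp only [D]
      rw [MeromorphicOn.AnalyticOnNhd.divisor_apply hf' hzb,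
        ← Nat.cast_analyticOrderNatAt htop]
      rfl
    have : analyticOrderNatAt f z ≠ 0 := by
      intro h
      rw [analyticOrderNatAt, ENat.toNat_eq_zero] at h
      tauto
    omega
  have hsub : Z ⊆ hfin.toFinset := by
    intro z hz
    have := hone z hz
    simp only [Set.Finite.coe_toFinset, Function.mem_support]
    omega
  have hZfin : Z.Finite := hfin.toFinset.finite_toSet.subset hsub
  refine ⟨hZfin, le_trans ?_ key⟩
  rw [finsum_eq_sum_of_support_subset (s := hfin.toFinset) _ (by simp),
    Set.ncard_eq_toFinset_card _ hZfin]
  have h1 : ((hZfin.toFinset.card : ℕ) : ℤ) ≤ ∑ u ∈ hZfin.toFinset, D u := by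
    rw [Finset.card_eq_sum_ones]
    push_cast
    exact Finset.sum_le_sum fun z hz => hone z (by simpa using hz)
  have h2 : ∑ u ∈ hZfin.toFinset, D u ≤ ∑ u ∈ hfin.toFinset, D u :=
    Finset.sum_le_sum_of_subset_of_nonneg (by
      intro z hz
      simpa using hsub (by simpa using hz)) fun u _ _ => hpos u
  exact_mod_cast h1.trans h2

namespace BeurlingSystem

open MeasureTheory Set

variable {S : BeurlingSystem} {A θ K₀ : ℝ}

theorem one_le_val (S : BeurlingSystem) (n : ℕ →₀ ℕ) : 1 ≤ S.val n := by
  simp only [val, Finsupp.prod]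
  exact Finset.one_le_prod fun k _ => one_le_pow₀ (S.one_lt_p k).le

theorem val_pos (S : BeurlingSystem) (n : ℕ →₀ ℕ) : 0 < S.val n :=
  one_pos.trans_le (S.one_le_val n)

theorem val_zero (S : BeurlingSystem) : S.val 0 = 1 := by simp [val]

theorem p_zero_le_val (S : BeurlingSystem) {n : ℕ →₀ ℕ} (hn : n ≠ 0) : S.p 0 ≤ S.val n := by
  obtain ⟨k, hk⟩ := Finsupp.support_nonempty_iff.mpr hn
  simp only [val, Finsupp.prod]
  rw [← Finset.mul_prod_erase _ _ hk]
  have h1 : S.p 0 ≤ S.p k := S.p_mono (Nat.zero_le k)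
  have h2 : S.p k ≤ S.p k ^ n k := le_self_pow₀ (S.one_lt_p k).le (by simpa using hk)
  have h3 : 1 ≤ ∏ x ∈ n.support.erase k, S.p x ^ n x :=
    Finset.one_le_prod fun j _ => one_le_pow₀ (S.one_lt_p j).le
  have h4 := S.one_lt_p k
  nlinarith

theorem cnt_eq_zero (S : BeurlingSystem) {x : ℝ} (hx : x < 1) : S.cnt x = 0 := by
  have : {n : ℕ →₀ ℕ | S.val n ≤ x} = ∅ := by
    ext n
    simpa using hx.trans_le (S.one_le_val n)
  simp [cnt, this]

theorem WellBehaved.finite_val_le (h : S.WellBehaved A θ K₀) (x : ℝ) :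
    {n : ℕ →₀ ℕ | S.val n ≤ x}.Finite := by
  obtain ⟨hA, -, hθ, -, hb⟩ := h
  by_contra hinf
  have ht := tendsto_rpow_atTop (sub_pos.mpr hθ)
  obtain ⟨y, hy, hy1, hyx⟩ := ((ht.eventually_gt_atTop (K₀ / A)).and
    ((eventually_ge_atTop 1).and (eventually_ge_atTop x))).exists
  have hinf' : {n : ℕ →₀ ℕ | S.val n ≤ y}.Infinite :=
    Set.Infinite.mono (fun n hn => le_trans hn hyx) hinf
  have hc : S.cnt y = 0 := by simp [cnt, hinf'.ncard]
  have h1 := hb y hy1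
  have hy0 : 0 < y := by linarith
  rw [hc, zero_sub, abs_neg, abs_of_pos (by positivity)] at h1
  rw [div_lt_iff₀ hA] at hy
  have h2 : y ^ (1 - θ) * y ^ θ = y := by
    rw [← Real.rpow_add hy0]
    simp
  have h3 : 0 < y ^ θ := by positivity
  nlinarith

theorem WellBehaved.cnt_mono (h : S.WellBehaved A θ K₀) : Monotone S.cnt := by
  intro x y hxy
  simp only [cnt, Nat.cast_le]
  exact Set.ncard_le_ncard (fun n hn => le_trans hn hxy) (h.finite_val_le y)

theorem WellBehaved.cnt_le (h : S.WellBehaved A θ K₀) {x : ℝ} (hx : 1 ≤ x) :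
    S.cnt x ≤ (A + K₀) * x := by
  obtain ⟨-, -, hθ, hK, hb⟩ := h
  have h1 := (abs_le.mp (hb x hx)).2
  have h2 : x ^ θ ≤ x := by simpa using Real.rpow_le_rpow_of_exponent_le hx hθ.le
  nlinarith

theorem integrableOn_indicator_Ici_cpow {s : ℂ} (hs : 0 < s.re) {v : ℝ} (hv : 1 ≤ v) :
    IntegrableOn ((Ici v).indicator fun x : ℝ => (x : ℂ) ^ (-s - 1)) (Ioi 0) := by
  refine IntegrableOn.integrable_indicator ?_ measurableSet_Ici |>.integrableOn
  rw [integrableOn_Ici_iff_integrableOn_Ioi]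
  exact integrableOn_Ioi_cpow_of_lt (by simp; linarith) (by linarith)

theorem integral_indicator_Ici_cpow {s : ℂ} (hs : 0 < s.re) {v : ℝ} (hv : 1 ≤ v) :
    ∫ x in Ioi (0 : ℝ), (Ici v).indicator (fun x : ℝ => (x : ℂ) ^ (-s - 1)) x
      = (v : ℂ) ^ (-s) / s := by
  rw [setIntegral_indicator measurableSet_Ici,
    inter_eq_right.mpr (Ici_subset_Ioi.mpr (by linarith)),
    integral_Ici_eq_integral_Ioi, integral_Ioi_cpow_of_lt (by simp; linarith) (by linarith)]
  simp [neg_div_neg_eq]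

theorem integrableOn_indicator_Ici_rpow {a v : ℝ} (ha : a < -1) (hv : 1 ≤ v) :
    IntegrableOn ((Ici v).indicator fun x : ℝ => x ^ a) (Ioi 0) := by
  refine IntegrableOn.integrable_indicator ?_ measurableSet_Ici |>.integrableOn
  rw [integrableOn_Ici_iff_integrableOn_Ioi]
  exact integrableOn_Ioi_rpow_of_lt ha (by linarith)

theorem integral_indicator_Ici_rpow {a v : ℝ} (ha : a < -1) (hv : 1 ≤ v) :
    ∫ x in Ioi (0 : ℝ), (Ici v).indicator (fun x : ℝ => x ^ a) x
      = v ^ (a + 1) / (-(a + 1)) := by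
  rw [setIntegral_indicator measurableSet_Ici,
    inter_eq_right.mpr (Ici_subset_Ioi.mpr (by linarith)),
    integral_Ici_eq_integral_Ioi, integral_Ioi_rpow_of_lt ha (by linarith), neg_div, div_neg]

theorem WellBehaved.sum_indicator_le_cnt (h : S.WellBehaved A θ K₀) (F : Finset (ℕ →₀ ℕ))
    (x b : ℝ) (hb : 0 ≤ b) :
    ∑ n ∈ F, (Ici (S.val n)).indicator (fun _ : ℝ => b) x ≤ S.cnt x * b := by
  classical
  simp only [indicator_apply, mem_Ici]
  rw [← Finset.sum_filter, Finset.sum_const, nsmul_eq_mul]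
  refine mul_le_mul_of_nonneg_right ?_ hb
  rw [cnt, Nat.cast_le, ← Set.ncard_coe_finset]
  exact Set.ncard_le_ncard (fun n hn => by simpa using (Finset.mem_filter.mp hn).2)
    (h.finite_val_le x)

theorem WellBehaved.summable_val_rpow (h : S.WellBehaved A θ K₀) {σ : ℝ} (hσ : 1 < σ) :
    Summable fun n => S.val n ^ (-σ) := by
  refine (summable_mul_right_iff (a := σ⁻¹) (by positivity)).mp ?_
  refine summable_of_sum_le (c := ∫ x in Ioi (0 : ℝ),
    (A + K₀) * (Ici (1 : ℝ)).indicator (fun x : ℝ => x ^ (-σ)) x)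
    (fun n => by have := S.val_pos n; positivity) fun F => ?_
  have h1 : ∀ n, S.val n ^ (-σ) * σ⁻¹ =
      ∫ x in Ioi (0 : ℝ), (Ici (S.val n)).indicator (fun x : ℝ => x ^ (-σ - 1)) x := by
    intro n
    rw [integral_indicator_Ici_rpow (by linarith) (S.one_le_val n)]
    simp [div_eq_mul_inv]
  have hint : ∀ n ∈ F, IntegrableOn
      ((Ici (S.val n)).indicator (fun x : ℝ => x ^ (-σ - 1))) (Ioi 0) := fun n _ =>
    integrableOn_indicator_Ici_rpow (by linarith) (S.one_le_val n)
  simp only [h1]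
  rw [← integral_finsetSum _ hint]
  refine setIntegral_mono_on (integrable_finsetSum _ hint)
    ((integrableOn_indicator_Ici_rpow (by linarith) le_rfl).const_mul _) measurableSet_Ioi ?_
  intro x hx
  have hx0 : (0 : ℝ) < x := hx
  have h2 := h.sum_indicator_le_cnt F x (x ^ (-σ - 1)) (by positivity)
  have h3 : ∀ n, (Ici (S.val n)).indicator (fun _ : ℝ => x ^ (-σ - 1)) x =
      (Ici (S.val n)).indicator (fun x : ℝ => x ^ (-σ - 1)) x := fun n => rfl
  simp only [h3] at h2
  refine h2.trans ?_
  by_cases hx1 : 1 ≤ x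
  · rw [indicator_of_mem (mem_Ici.mpr hx1), Real.rpow_sub_one hx0.ne']
    have h4 := mul_le_mul_of_nonneg_right (h.cnt_le hx1) (show 0 ≤ x ^ (-σ) / x by positivity)
    refine h4.trans (le_of_eq ?_)
    field_simp
  · rw [S.cnt_eq_zero (not_le.mp hx1), indicator_of_notMem (by simpa using hx1)]
    simp

theorem WellBehaved.tsum_indicator (h : S.WellBehaved A θ K₀) (x : ℝ) (b : ℝ → ℂ) :
    ∑' n, (Ici (S.val n)).indicator b x = S.cnt x * b x := by
  rw [tsum_eq_sum (s := (h.finite_val_le x).toFinset)]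
  · rw [Finset.sum_congr rfl (g := fun _ => b x), Finset.sum_const, nsmul_eq_mul, cnt,
      Set.ncard_eq_toFinset_card _ (h.finite_val_le x)]
    · simp
    · intro n hn
      exact indicator_of_mem (by simpa using hn) _
  · intro n hn
    exact indicator_of_notMem (by simpa using hn) _

theorem WellBehaved.hasSum_val_cpow_div (h : S.WellBehaved A θ K₀) {s : ℂ} (hs : 1 < s.re) :
    HasSum (fun n => (S.val n : ℂ) ^ (-s) / s)
      (∫ x in Ioi (0 : ℝ), (S.cnt x : ℂ) * (x : ℂ) ^ (-s - 1)) := by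
  have hs0 : 0 < s.re := by linarith
  have key := hasSum_integral_of_summable_integral_norm (μ := volume.restrict (Ioi (0 : ℝ)))
    (F := fun n => (Ici (S.val n)).indicator fun x : ℝ => (x : ℂ) ^ (-s - 1))
    (fun n => integrableOn_indicator_Ici_cpow hs0 (S.one_le_val n)) ?_
  · simpa only [integral_indicator_Ici_cpow hs0 (S.one_le_val _), h.tsum_indicator] using key
  · have h1 : ∀ n, ∫ x in Ioi (0 : ℝ),
        ‖(Ici (S.val n)).indicator (fun x : ℝ => (x : ℂ) ^ (-s - 1)) x‖
          = S.val n ^ (-s.re) * s.re⁻¹ := by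
      intro n
      rw [setIntegral_congr_fun (g := (Ici (S.val n)).indicator fun x : ℝ => x ^ (-s.re - 1))
        measurableSet_Ioi, integral_indicator_Ici_rpow (by linarith) (S.one_le_val n)]
      · simp [div_eq_mul_inv]
      · intro x hx
        by_cases hx1 : S.val n ≤ x
        · simp [hx1, Complex.norm_cpow_eq_rpow_re_of_pos (mem_Ioi.mp hx)]
        · simp [hx1]
    simp only [h1]
    exact (h.summable_val_rpow hs).mul_right _

/-- The remainder `N(x) - A x`, extended by `0` to `x < 1`. -/
noncomputable def remainder (S : BeurlingSystem) (A x : ℝ) : ℂ :=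
  (Ici (1 : ℝ)).indicator (fun x => ((S.cnt x - A * x : ℝ) : ℂ)) x

theorem WellBehaved.norm_remainder_le (h : S.WellBehaved A θ K₀) (x : ℝ) :
    ‖S.remainder A x‖ ≤ (Ici (1 : ℝ)).indicator (fun x => K₀ * x ^ θ) x := by
  rw [remainder, norm_indicator_eq_indicator_norm]
  refine indicator_le_indicator' fun hx => ?_
  rw [Complex.norm_real]
  exact h.2.2.2.2 x hx

theorem WellBehaved.measurable_remainder (h : S.WellBehaved A θ K₀) :
    Measurable (S.remainder A) := by
  refine Measurable.indicator ?_ measurableSet_Ici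
  have := h.cnt_mono.measurable
  fun_prop

theorem WellBehaved.locallyIntegrableOn_remainder (h : S.WellBehaved A θ K₀) :
    LocallyIntegrableOn (S.remainder A) (Ioi 0) := by
  have hg : LocallyIntegrableOn (fun x : ℝ => K₀ * x ^ θ) (Ioi 0) := by
    refine ContinuousOn.locallyIntegrableOn ?_ measurableSet_Ioi
    exact continuousOn_const.mul fun x hx =>
      (Real.continuousAt_rpow_const _ _ (Or.inl (ne_of_gt hx))).continuousWithinAt
  refine hg.mono h.measurable_remainder.aestronglyMeasurable ?_
  refine .of_forall fun x => (h.norm_remainder_le x).trans ?_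
  by_cases hx : 1 ≤ x
  · rw [indicator_of_mem (mem_Ici.mpr hx)]
    exact le_abs_self _
  · rw [indicator_of_notMem (by simpa using hx)]
    exact norm_nonneg _

theorem WellBehaved.differentiableAt_mellin (h : S.WellBehaved A θ K₀) {s : ℂ} (hs : θ < s.re) :
    DifferentiableAt ℂ (fun s => mellin (S.remainder A) (-s)) s := by
  have : DifferentiableAt ℂ (mellin (S.remainder A)) (-s) := by
    refine mellin_differentiableAt_of_isBigO_rpow (a := -θ) (b := -s.re - 1)
      h.locallyIntegrableOn_remainder ?_ (by simpa using hs) ?_ (by simp)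
    · refine Asymptotics.IsBigO.of_bound K₀ ?_
      filter_upwards [eventually_ge_atTop 1] with x hx
      have h1 := h.norm_remainder_le x
      rw [indicator_of_mem (mem_Ici.mpr hx)] at h1
      have h2 : 0 ≤ x ^ θ := by positivity
      simpa [abs_of_nonneg h2] using h1
    · refine Filter.EventuallyEq.trans_isBigO (f₂ := fun _ => (0 : ℂ)) ?_
        (Asymptotics.isBigO_zero _ _)
      filter_upwards [nhdsWithin_le_nhds (Iio_mem_nhds (zero_lt_one (α := ℝ)))] with x hx
      exact indicator_of_notMem (by simpa using hx) _
  exact this.comp s differentiableAt_id.neg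

theorem WellBehaved.norm_cpow_smul_remainder_le (h : S.WellBehaved A θ K₀) (s : ℂ) {x : ℝ}
    (hx : 0 < x) :
    ‖(x : ℂ) ^ (-s - 1) • S.remainder A x‖ ≤
      K₀ * (Ici (1 : ℝ)).indicator (fun x : ℝ => x ^ (θ - s.re - 1)) x := by
  rw [norm_smul, Complex.norm_cpow_eq_rpow_re_of_pos hx]
  have h2 := h.norm_remainder_le x
  have h3 := mul_le_mul_of_nonneg_left h2 (show 0 ≤ x ^ (-s - 1).re by positivity)
  refine h3.trans (le_of_eq ?_)
  by_cases hx1 : 1 ≤ x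
  · rw [indicator_of_mem (mem_Ici.mpr hx1), indicator_of_mem (mem_Ici.mpr hx1),
      mul_left_comm, ← Real.rpow_add hx]
    congr 2
    simp
    ring
  · rw [indicator_of_notMem (by simpa using hx1), indicator_of_notMem (by simpa using hx1)]
    simp

theorem WellBehaved.integrableOn_cpow_smul_remainder (h : S.WellBehaved A θ K₀) {s : ℂ}
    (hs : θ < s.re) :
    IntegrableOn (fun x : ℝ => (x : ℂ) ^ (-s - 1) • S.remainder A x) (Ioi 0) := by
  refine Integrable.mono' ((integrableOn_indicator_Ici_rpow (a := θ - s.re - 1) (v := 1)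
    (by linarith) le_rfl).const_mul K₀) ?_ ?_
  · have := h.measurable_remainder
    exact Measurable.aestronglyMeasurable (by fun_prop)
  · rw [ae_restrict_iff' measurableSet_Ioi]
    exact .of_forall fun x hx => h.norm_cpow_smul_remainder_le s hx

theorem WellBehaved.norm_mellin_le (h : S.WellBehaved A θ K₀) {s : ℂ} (hs : θ < s.re) :
    ‖mellin (S.remainder A) (-s)‖ ≤ K₀ / (s.re - θ) := by
  have hint := integrableOn_indicator_Ici_rpow (a := θ - s.re - 1) (v := 1) (by linarith) le_rfl
  have h1 := norm_integral_le_of_norm_le (μ := volume.restrict (Ioi (0 : ℝ)))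
    (f := fun t : ℝ => (t : ℂ) ^ (-s - 1) • S.remainder A t) (hint.const_mul K₀)
    ((ae_restrict_iff' measurableSet_Ioi).mpr
      (.of_forall fun x hx => h.norm_cpow_smul_remainder_le s hx))
  rw [integral_const_mul, integral_indicator_Ici_rpow (by linarith) le_rfl] at h1
  refine h1.trans (le_of_eq ?_)
  simp [div_eq_mul_inv]

/-- The function `(s - 1) ζ(s)`, continued to the half-plane `Re s > θ`. -/
noncomputable def regularizedZeta (S : BeurlingSystem) (A : ℝ) (s : ℂ) : ℂ :=
  s * (A + (s - 1) * mellin (S.remainder A) (-s))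

theorem WellBehaved.differentiableOn_regularizedZeta (h : S.WellBehaved A θ K₀) :
    DifferentiableOn ℂ (S.regularizedZeta A) {s | θ < s.re} := by
  intro s hs
  have := h.differentiableAt_mellin hs
  unfold regularizedZeta
  exact DifferentiableAt.differentiableWithinAt (by fun_prop)

theorem WellBehaved.norm_regularizedZeta_le (h : S.WellBehaved A θ K₀) {a : ℝ} (ha : θ < a)
    {s : ℂ} (hs : a ≤ s.re) :
    ‖S.regularizedZeta A s‖ ≤ (A + K₀ / (a - θ)) * (1 + ‖s‖) ^ 2 := by
  have hA := h.1
  have hK := h.2.2.2.1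
  have ha' : 0 < a - θ := by linarith
  have h1 : ‖mellin (S.remainder A) (-s)‖ ≤ K₀ / (a - θ) :=
    (h.norm_mellin_le (ha.trans_le hs)).trans (by gcongr)
  have h2 : ‖s - 1‖ ≤ ‖s‖ + 1 := by simpa using norm_sub_le s 1
  have h3 : 0 ≤ K₀ / (a - θ) := by positivity
  calc ‖S.regularizedZeta A s‖
      ≤ ‖s‖ * (‖(A : ℂ)‖ + ‖s - 1‖ * ‖mellin (S.remainder A) (-s)‖) := by
        rw [regularizedZeta, norm_mul]
        gcongr
        exact (norm_add_le _ _).trans (by rw [norm_mul])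
    _ ≤ ‖s‖ * (A + (‖s‖ + 1) * (K₀ / (a - θ))) := by
        rw [Complex.norm_real, Real.norm_of_nonneg hA.le]
        gcongr
    _ ≤ _ := by
        have := norm_nonneg s
        have : 0 ≤ A * ‖s‖ := by positivity
        have : 0 ≤ K₀ / (a - θ) * ‖s‖ := by positivity
        have : 0 ≤ A * ‖s‖ ^ 2 := by positivity
        nlinarith

theorem WellBehaved.regularizedZeta_eq (h : S.WellBehaved A θ K₀) {s : ℂ} (hs : 1 < s.re) :
    S.regularizedZeta A s = (s - 1) * ∑' n, (S.val n : ℂ) ^ (-s) := by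
  have hs0 : s ≠ 0 := by
    rintro rfl
    simp at hs
    linarith
  have hs1 : s - 1 ≠ 0 := by
    intro h0
    rw [sub_eq_zero.mp h0] at hs
    simp at hs
  have hsum := (h.hasSum_val_cpow_div hs).tsum_eq
  rw [tsum_div_const, div_eq_iff hs0] at hsum
  have hA := integral_indicator_Ici_cpow (s := s - 1) (v := 1) (by simpa using hs) le_rfl
  have hAi := integrableOn_indicator_Ici_cpow (s := s - 1) (v := 1) (by simpa using hs) le_rfl
  have hR : IntegrableOn (fun t : ℝ => (t : ℂ) ^ (-s - 1) • S.remainder A t) (Ioi 0) :=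
    h.integrableOn_cpow_smul_remainder (h.2.2.1.trans hs)
  have hsplit : ∫ x in Ioi (0 : ℝ), (S.cnt x : ℂ) * (x : ℂ) ^ (-s - 1)
      = mellin (S.remainder A) (-s) + A * (1 / (s - 1)) := by
    rw [Complex.ofReal_one, Complex.one_cpow] at hA
    rw [← hA, ← integral_const_mul, mellin, ← integral_add hR (hAi.const_mul _)]
    refine setIntegral_congr_fun measurableSet_Ioi fun x hx => ?_
    have hx0 : (x : ℂ) ≠ 0 := by exact_mod_cast (ne_of_gt hx)
    by_cases hx1 : 1 ≤ x
    · have h3 : (x : ℂ) ^ (-(s - 1) - 1) = x * (x : ℂ) ^ (-s - 1) := by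
        rw [show -(s - 1) - 1 = (-s - 1) + 1 by ring, Complex.cpow_add _ _ hx0]
        simp [mul_comm]
      simp only [remainder, indicator_of_mem (mem_Ici.mpr hx1), h3, smul_eq_mul]
      push_cast
      ring
    · simp [remainder, hx1, S.cnt_eq_zero (not_le.mp hx1)]
  rw [hsum, hsplit, regularizedZeta]
  field_simp
  ring

theorem WellBehaved.regularizedZeta_eq_of_isZeta (h : S.WellBehaved A θ K₀) {ζ : ℂ → ℂ}
    (hζ : S.IsZeta θ ζ) {s : ℂ} (hs : θ < s.re) (him : s.im ≠ 0) :
    S.regularizedZeta A s = (s - 1) * ζ s := by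
  have key : ∀ (V : Set ℂ), IsOpen V → IsPreconnected ({s : ℂ | θ < s.re} ∩ V) → (1 : ℂ) ∉ V →
      ∀ w ∈ V, 1 < w.re → s ∈ V → S.regularizedZeta A s = (s - 1) * ζ s := by
    intro V hV hconn h1 w hw hwre hsV
    have hU : IsOpen ({s : ℂ | θ < s.re} ∩ V) :=
      (isOpen_lt continuous_const Complex.continuous_re).inter hV
    have hζd : DifferentiableOn ℂ ζ ({s : ℂ | θ < s.re} ∩ V) :=
      hζ.1.mono fun z hz => ⟨hz.1, fun hz1 => h1 (hz1 ▸ hz.2)⟩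
    have hf := (h.differentiableOn_regularizedZeta.mono inter_subset_left).analyticOnNhd hU
    have hg := (((differentiable_id.sub_const (1 : ℂ)).differentiableOn).mul hζd).analyticOnNhd hU
    refine hf.eqOn_of_preconnected_of_eventuallyEq hg hconn
      (z₀ := w) ⟨h.2.2.1.trans hwre, hw⟩ ?_ ⟨hs, hsV⟩
    filter_upwards [(isOpen_lt continuous_const Complex.continuous_re).mem_nhds hwre] with z hz
    simp only [Pi.mul_apply, id]
    rw [h.regularizedZeta_eq hz, hζ.2 z hz]
  rcases him.lt_or_gt with hlt | hgt
  · exact key {z | z.im < 0} (isOpen_lt Complex.continuous_im continuous_const)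
      ((convex_halfSpace_re_gt θ).inter (convex_halfSpace_im_lt 0)).isPreconnected (by simp)
      ⟨2, -1⟩ (by simp) (by norm_num) hlt
  · exact key {z | 0 < z.im} (isOpen_lt continuous_const Complex.continuous_im)
      ((convex_halfSpace_re_gt θ).inter (convex_halfSpace_im_gt 0)).isPreconnected (by simp)
      ⟨2, 1⟩ (by simp) (by norm_num) hgt

theorem WellBehaved.eventually_half_le_norm_tsum (h : S.WellBehaved A θ K₀) :
    ∀ᶠ σ : ℝ in atTop, ∀ s : ℂ, s.re = σ → 1 / 2 ≤ ‖∑' n, (S.val n : ℂ) ^ (-s)‖ := by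
  have hp := S.one_lt_p 0
  have hp0 : 0 < S.p 0 := by linarith
  have hlim : Tendsto (fun σ : ℝ => S.p 0 ^ (2 - σ) * ∑' n, S.val n ^ (-2 : ℝ)) atTop
      (𝓝 (0 * ∑' n, S.val n ^ (-2 : ℝ))) := by
    refine Tendsto.mul_const _ ?_
    refine (tendsto_rpow_atBot_of_base_gt_one _ hp).comp ?_
    exact tendsto_atBot_add_const_left _ 2 tendsto_neg_atTop_atBot
  rw [zero_mul] at hlim
  filter_upwards [hlim.eventually_lt_const one_half_pos, eventually_ge_atTop 2] with σ hσ hσ2 s hs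
  have hnorm : ∀ n, ‖(S.val n : ℂ) ^ (-s)‖ = S.val n ^ (-σ) := fun n => by
    rw [Complex.norm_cpow_eq_rpow_re_of_pos (S.val_pos n), Complex.neg_re, hs]
  have hsum : Summable fun n => (S.val n : ℂ) ^ (-s) := by
    refine Summable.of_norm ?_
    simp only [hnorm]
    exact h.summable_val_rpow (by linarith)
  have hle : ∀ n, ‖if n = 0 then (0 : ℂ) else (S.val n : ℂ) ^ (-s)‖ ≤
      S.p 0 ^ (2 - σ) * S.val n ^ (-2 : ℝ) := by
    intro n
    have hv := S.val_pos n
    split_ifs with hn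
    · rw [norm_zero]
      positivity
    · rw [hnorm, show -σ = (2 - σ) + (-2) by ring, Real.rpow_add hv]
      have : S.val n ^ (2 - σ) ≤ S.p 0 ^ (2 - σ) :=
        Real.rpow_le_rpow_of_nonpos hp0 (S.p_zero_le_val hn) (by linarith)
      gcongr
  have h2 := tsum_of_norm_bounded
    ((h.summable_val_rpow (σ := 2) (by norm_num)).mul_left (S.p 0 ^ (2 - σ))).hasSum hle
  rw [tsum_mul_left] at h2
  rw [hsum.tsum_eq_add_tsum_ite 0, S.val_zero, Complex.ofReal_one, Complex.one_cpow]
  have h3 := norm_sub_le_norm_add (1 : ℂ) (∑' n, if n = 0 then (0 : ℂ) else (S.val n : ℂ) ^ (-s))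
  rw [norm_one] at h3
  linarith

theorem WellBehaved.exists_ncard_zeros_le (h : S.WellBehaved A θ K₀) {ζ : ℂ → ℂ}
    (hζ : S.IsZeta θ ζ) {α : ℝ} (hα : θ < α) :
    ∃ C : ℝ, ∀ t : ℝ, 2 < |t| →
      {ρ : ℂ | ζ ρ = 0 ∧ α ≤ ρ.re ∧ ρ.re ≤ 1 ∧ |ρ.im - t| ≤ 1}.Finite ∧
      ({ρ : ℂ | ζ ρ = 0 ∧ α ≤ ρ.re ∧ ρ.re ≤ 1 ∧ |ρ.im - t| ≤ 1}.ncard : ℝ)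
        ≤ C * Real.log |t| := by
  obtain ⟨δ, hδ, hδα⟩ : ∃ δ > 0, θ < α - δ := ⟨(α - θ) / 2, by linarith, by linarith⟩
  obtain ⟨σ, hσ, hσ2, hσα⟩ := (h.eventually_half_le_norm_tsum.and
    ((eventually_ge_atTop 2).and (eventually_ge_atTop (α + 1 + 1 / (2 * δ))))).exists
  have hd : 0 < 1 / (2 * δ) := by positivity
  set R := σ - (α - δ) with hRdef
  set r := √((σ - α) ^ 2 + 1) with hrdef
  have hr : 0 < r := by positivity
  have hR : 0 < R := by linarith
  have hrR : r < R := by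
    rw [hrdef, Real.sqrt_lt' hR]
    have h1 : 1 / (2 * δ) * (2 * δ) = 1 := by field_simp
    have h2 : 1 / (2 * δ) * (2 * δ) ≤ (σ - α) * (2 * δ) := by gcongr; linarith
    nlinarith
  set B := A + K₀ / (α - δ - θ)
  have hB : 0 ≤ B := add_nonneg h.1.le (div_nonneg h.2.2.2.1 (by linarith))
  set L := 2 + σ + R with hLdef
  set D := max 1 (B * L ^ 2)
  have hD1 : 1 ≤ D := le_max_left _ _
  have hlogR : 0 < Real.log (R / r) := Real.log_pos ((one_lt_div hr).mpr hrR)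
  refine ⟨(Real.log (2 * D) / Real.log 2 + 2) / Real.log (R / r), fun t ht => ?_⟩
  set c : ℂ := ⟨σ, t⟩
  have hre : ∀ z ∈ Metric.closedBall c R, α - δ ≤ z.re := by
    intro z hz
    rw [mem_closedBall_iff_norm] at hz
    have := (abs_le.mp ((Complex.abs_re_le_norm (z - c)).trans hz)).1
    simp only [Complex.sub_re, c] at this
    linarith
  have hcnorm : ‖c‖ ≤ σ + |t| := by
    refine (Complex.norm_le_abs_re_add_abs_im c).trans ?_
    simp only [c]
    rw [abs_of_nonneg (by linarith : 0 ≤ σ)]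
  have hfc : 1 / 2 ≤ ‖S.regularizedZeta A c‖ := by
    rw [h.regularizedZeta_eq (by simp only [c]; linarith), norm_mul]
    have h1 := hσ c rfl
    have h2 : 1 ≤ ‖c - 1‖ := by
      refine le_trans ?_ (Complex.re_le_norm _)
      simp only [Complex.sub_re, Complex.one_re, c]
      linarith
    nlinarith
  have hMT : 1 ≤ D * |t| ^ 2 := by nlinarith
  have hbound : ∀ z ∈ Metric.sphere c R, ‖S.regularizedZeta A z‖ ≤ D * |t| ^ 2 := by
    intro z hz
    refine (h.norm_regularizedZeta_le hδα (hre z (Metric.sphere_subset_closedBall hz))).trans ?_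
    have hz1 : ‖z‖ ≤ σ + |t| + R := by
      have h1 := norm_le_norm_add_norm_sub' z c
      rw [mem_sphere_iff_norm] at hz
      linarith
    have hz2 : 1 + ‖z‖ ≤ L * |t| := by nlinarith
    calc B * (1 + ‖z‖) ^ 2 ≤ B * (L * |t|) ^ 2 := by gcongr
      _ = B * L ^ 2 * |t| ^ 2 := by ring
      _ ≤ D * |t| ^ 2 := by
        gcongr
        exact le_max_right _ _
  have hZ : {ρ : ℂ | ζ ρ = 0 ∧ α ≤ ρ.re ∧ ρ.re ≤ 1 ∧ |ρ.im - t| ≤ 1} ⊆ Metric.closedBall c r := by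
    rintro ρ ⟨-, h1, h2, h3⟩
    rw [mem_closedBall_iff_norm, Complex.norm_eq_sqrt_sq_add_sq, hrdef]
    refine Real.sqrt_le_sqrt (add_le_add ?_ ?_)
    · simp only [Complex.sub_re, c]
      nlinarith
    · simp only [Complex.sub_im, c]
      exact (sq_le_one_iff_abs_le_one _).mpr h3
  have hZ0 : ∀ ρ ∈ {ρ : ℂ | ζ ρ = 0 ∧ α ≤ ρ.re ∧ ρ.re ≤ 1 ∧ |ρ.im - t| ≤ 1},
      S.regularizedZeta A ρ = 0 := by
    rintro ρ ⟨h0, h1, -, h3⟩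
    have him : ρ.im ≠ 0 := by
      intro h4
      rw [h4, zero_sub, abs_neg] at h3
      linarith
    rw [h.regularizedZeta_eq_of_isZeta hζ (hα.trans_le h1) him, h0, mul_zero]
  obtain ⟨hfin, hcard⟩ := AnalyticOnNhd.ncard_zeros_le (f := S.regularizedZeta A) (c := c)
    (Z := {ρ : ℂ | ζ ρ = 0 ∧ α ≤ ρ.re ∧ ρ.re ≤ 1 ∧ |ρ.im - t| ≤ 1}) hr hrR hMT
    ((h.differentiableOn_regularizedZeta.analyticOnNhd
      (isOpen_lt continuous_const Complex.continuous_re)).mono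
        fun z hz => hδα.trans_le (hre z hz))
    (norm_pos_iff.mp (by linarith)) hbound hZ hZ0
  refine ⟨hfin, hcard.trans ?_⟩
  rw [div_mul_eq_mul_div]
  refine div_le_div_of_nonneg_right ?_ hlogR.le
  have hlog2 : 0 < Real.log 2 := Real.log_pos one_lt_two
  have hlt : Real.log 2 ≤ Real.log |t| := Real.log_le_log two_pos ht.le
  calc Real.log (D * |t| ^ 2 / ‖S.regularizedZeta A c‖)
      ≤ Real.log (2 * D * |t| ^ 2) := by
        refine Real.log_le_log (div_pos (by linarith) (by linarith)) ?_
        rw [div_le_iff₀ (by linarith)]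
        nlinarith
    _ = Real.log (2 * D) + 2 * Real.log |t| := by
        rw [Real.log_mul (by positivity) (by positivity), Real.log_pow]
        norm_num
    _ ≤ _ := by
        have h1 : 0 ≤ Real.log (2 * D) := Real.log_nonneg (by linarith)
        have h2 : Real.log (2 * D) / Real.log 2 * Real.log 2
            ≤ Real.log (2 * D) / Real.log 2 * Real.log |t| := by gcongr
        rw [div_mul_cancel₀ _ hlog2.ne'] at h2
        linarith

end BeurlingSystem

/-- **Local count of zeros** (Lemma 1.1, Révész). If `N(x) = Ax + O(x^θ)`, then for
each `α > θ` there is `C_α` such that for each `T > 2`, the number of zeros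
`ρ = β + iγ` of the Beurling zeta function with `β ∈ [α, 1]` and `|γ| ∈ [T, T+1]`
is at most `C_α log T`. -/
theorem beurling_local_zero_count
    (S : BeurlingSystem) (A θ K₀ : ℝ) (hWB : S.WellBehaved A θ K₀)
    (ζ : ℂ → ℂ) (hζ : S.IsZeta θ ζ) :
    ∀ α : ℝ, θ < α →
      ∃ C : ℝ, ∀ T : ℝ, 2 < T →
        (Set.ncard {ρ : ℂ | ζ ρ = 0 ∧ ρ ≠ 1 ∧ α ≤ ρ.re ∧ ρ.re ≤ 1 ∧
            T ≤ |ρ.im| ∧ |ρ.im| ≤ T + 1} : ℝ)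
          ≤ C * Real.log T := by
  intro α hα
  obtain ⟨C, hC⟩ := hWB.exists_ncard_zeros_le hζ hα
  refine ⟨2 * C, fun T hT => ?_⟩
  have hTabs : |T| = T := abs_of_pos (by linarith)
  obtain ⟨hfin₁, hcard₁⟩ := hC T (by rwa [hTabs])
  obtain ⟨hfin₂, hcard₂⟩ := hC (-T) (by rwa [abs_neg, hTabs])
  rw [hTabs] at hcard₁
  rw [abs_neg, hTabs] at hcard₂
  have hsub : {ρ : ℂ | ζ ρ = 0 ∧ ρ ≠ 1 ∧ α ≤ ρ.re ∧ ρ.re ≤ 1 ∧ T ≤ |ρ.im| ∧ |ρ.im| ≤ T + 1} ⊆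
      {ρ : ℂ | ζ ρ = 0 ∧ α ≤ ρ.re ∧ ρ.re ≤ 1 ∧ |ρ.im - T| ≤ 1} ∪
      {ρ : ℂ | ζ ρ = 0 ∧ α ≤ ρ.re ∧ ρ.re ≤ 1 ∧ |ρ.im - -T| ≤ 1} := by
    rintro ρ ⟨h0, -, h1, h2, h3, h4⟩
    rcases le_total 0 ρ.im with him | him
    · rw [abs_of_nonneg him] at h3 h4
      exact Or.inl ⟨h0, h1, h2, abs_le.mpr ⟨by linarith, by linarith⟩⟩
    · rw [abs_of_nonpos him] at h3 h4
      exact Or.inr ⟨h0, h1, h2, abs_le.mpr ⟨by linarith, by linarith⟩⟩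
  have hle := (Set.ncard_le_ncard hsub (hfin₁.union hfin₂)).trans (Set.ncard_union_le _ _)
  refine (Nat.cast_le (α := ℝ).mpr hle).trans ?_
  push_cast
  linarith
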